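/- Let k ≥ 2 be an integer, n > 2k, σ ∈ [0,2k), p > 1 and c > 0. Suppose u is positive, of class C^{2k} on ℝⁿ∖{0} and continuous on ℝⁿ, and satisfies the differential inequality (−Δ)^k u(x) ≥ c |x|^{−σ} u(x)^p for all x ∈ ℝⁿ∖{0}. Then (−Δ)^j u(x) > 0 for all x ∈ ℝⁿ∖{0} and all j = 1,…,k−1. -/

import Mathlib

open MeasureTheory

noncomputable section

/-- The Laplacian of `u : ℝⁿ → ℝ`: the sum of the pure second partial
derivatives along the coordinate directions. -/
def laplacian {n : ℕ} (u : EuclideanSpace ℝ (Fin n) → ℝ)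
    (x : EuclideanSpace ℝ (Fin n)) : ℝ :=
  ∑ i : Fin n,
    iteratedFDeriv ℝ 2 u x ![EuclideanSpace.single i 1, EuclideanSpace.single i 1]

/-- `(-Δ)^j`, the j-th iterate of the negative Laplacian. -/
def negLapPow {n : ℕ} (j : ℕ) (u : EuclideanSpace ℝ (Fin n) → ℝ) :
    EuclideanSpace ℝ (Fin n) → ℝ :=
  (fun v x => -laplacian v x)^[j] u

open Set Filter Topology
open scoped ContDiff

/-! ### The Laplacian and its iterates -/

section Laplacian

variable {n : ℕ}

lemma laplacian_eq_sum_fderiv {u : EuclideanSpace ℝ (Fin n) → ℝ} {x : EuclideanSpace ℝ (Fin n)}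
    (hu : ContDiffAt ℝ 2 u x) :
    laplacian u x = ∑ i : Fin n, fderiv ℝ (fun y => fderiv ℝ u y (EuclideanSpace.single i 1)) x
      (EuclideanSpace.single i 1) := by
  unfold laplacian
  refine Finset.sum_congr rfl fun i _ => ?_
  have hd : DifferentiableAt ℝ (fderiv ℝ u) x :=
    (hu.fderiv_right (m := 1) (by norm_num)).differentiableAt (by norm_num)
  rw [iteratedFDeriv_two_apply, fderiv_clm_apply hd (differentiableAt_const _)]
  simp

lemma laplacian_congr_of_eventuallyEq {u v : EuclideanSpace ℝ (Fin n) → ℝ}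
    {x : EuclideanSpace ℝ (Fin n)} (h : u =ᶠ[𝓝 x] v) : laplacian u x = laplacian v x := by
  unfold laplacian
  rw [(h.iteratedFDeriv ℝ 2).eq_of_nhds]

lemma negLapPow_zero (u : EuclideanSpace ℝ (Fin n) → ℝ) : negLapPow 0 u = u := rfl

lemma negLapPow_succ (j : ℕ) (u : EuclideanSpace ℝ (Fin n) → ℝ) :
    negLapPow (j + 1) u = fun x => -laplacian (negLapPow j u) x := by
  unfold negLapPow
  rw [Function.iterate_succ_apply']

lemma negLapPow_succ_eq_negLapPow (j : ℕ) (u : EuclideanSpace ℝ (Fin n) → ℝ) :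
    negLapPow (j + 1) u = negLapPow j (fun x => -laplacian u x) := by
  unfold negLapPow
  rw [Function.iterate_succ_apply]

lemma ContDiffOn.laplacian_of_isOpen {u : EuclideanSpace ℝ (Fin n) → ℝ}
    {U : Set (EuclideanSpace ℝ (Fin n))} (hU : IsOpen U) {m N : WithTop ℕ∞}
    (hu : ContDiffOn ℝ N u U) (hm : m + 2 ≤ N) : ContDiffOn ℝ m (laplacian u) U := by
  have h2 : ContDiffOn ℝ m (fun x => ∑ i : Fin n,
      fderiv ℝ (fun y => fderiv ℝ u y (EuclideanSpace.single i 1)) x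
        (EuclideanSpace.single i 1)) U := by
    refine ContDiffOn.sum fun i _ => ?_
    have h1 : ContDiffOn ℝ (m + 1) (fun y => fderiv ℝ u y (EuclideanSpace.single i 1)) U := by
      refine (hu.fderiv_of_isOpen hU ?_).clm_apply contDiffOn_const
      rwa [add_assoc, one_add_one_eq_two]
    exact (h1.fderiv_of_isOpen hU le_rfl).clm_apply contDiffOn_const
  refine h2.congr fun x hx => laplacian_eq_sum_fderiv ?_
  exact ((hu x hx).contDiffAt (hU.mem_nhds hx)).of_le (le_trans (by simp) hm)

lemma ContDiff.laplacian {φ : EuclideanSpace ℝ (Fin n) → ℝ} (hφ : ContDiff ℝ ∞ φ) :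
    ContDiff ℝ ∞ (laplacian φ) :=
  contDiffOn_univ.1 (hφ.contDiffOn.laplacian_of_isOpen isOpen_univ (by decide))

lemma ContDiff.negLapPow {φ : EuclideanSpace ℝ (Fin n) → ℝ} (hφ : ContDiff ℝ ∞ φ) (j : ℕ) :
    ContDiff ℝ ∞ (negLapPow j φ) := by
  induction j with
  | zero => exact hφ
  | succ j ih => rw [negLapPow_succ]; exact ih.laplacian.neg

lemma ContDiffOn.negLapPow_of_isOpen {u : EuclideanSpace ℝ (Fin n) → ℝ}
    {U : Set (EuclideanSpace ℝ (Fin n))} (hU : IsOpen U) {j l : ℕ}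
    (hu : ContDiffOn ℝ ((2 * j + l : ℕ) : WithTop ℕ∞) u U) :
    ContDiffOn ℝ l (negLapPow j u) U := by
  induction j generalizing l with
  | zero => simpa [negLapPow_zero] using hu
  | succ j ih =>
    rw [negLapPow_succ]
    refine ((ih (l := l + 2) ?_).laplacian_of_isOpen hU (by simp)).neg
    rwa [show 2 * j + (l + 2) = 2 * (j + 1) + l by ring]

lemma tsupport_laplacian_subset (φ : EuclideanSpace ℝ (Fin n) → ℝ) :
    tsupport (laplacian φ) ⊆ tsupport φ := by
  refine closure_minimal (fun x hx => ?_) (isClosed_tsupport φ)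
  by_contra h
  refine hx ?_
  rw [laplacian_congr_of_eventuallyEq (notMem_tsupport_iff_eventuallyEq.1 h)]
  simp [laplacian]

lemma tsupport_negLapPow_subset (φ : EuclideanSpace ℝ (Fin n) → ℝ) (j : ℕ) :
    tsupport (negLapPow j φ) ⊆ tsupport φ := by
  induction j with
  | zero => exact subset_rfl
  | succ j ih =>
    rw [negLapPow_succ]
    have : tsupport (fun x => -laplacian (negLapPow j φ) x)
        = tsupport (laplacian (negLapPow j φ)) := by
      rw [tsupport, tsupport, Function.support_fun_neg]
    rw [this]
    exact (tsupport_laplacian_subset _).trans ih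

lemma laplacian_sub {φ ψ : EuclideanSpace ℝ (Fin n) → ℝ} (hφ : ContDiff ℝ ∞ φ)
    (hψ : ContDiff ℝ ∞ ψ) (x : EuclideanSpace ℝ (Fin n)) :
    laplacian (fun y => φ y - ψ y) x = laplacian φ x - laplacian ψ x := by
  have h2 : (2 : WithTop ℕ∞) ≤ ∞ := by decide
  unfold laplacian
  rw [← Finset.sum_sub_distrib]
  refine Finset.sum_congr rfl fun i _ => ?_
  rw [show (fun y => φ y - ψ y) = φ - ψ from rfl,
    iteratedFDeriv_sub_apply (hφ.of_le h2).contDiffAt (hψ.of_le h2).contDiffAt]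
  rfl

lemma negLapPow_sub {φ ψ : EuclideanSpace ℝ (Fin n) → ℝ} (hφ : ContDiff ℝ ∞ φ)
    (hψ : ContDiff ℝ ∞ ψ) (j : ℕ) :
    negLapPow j (fun y => φ y - ψ y) = fun x => negLapPow j φ x - negLapPow j ψ x := by
  induction j with
  | zero => rfl
  | succ j ih =>
    funext x
    simp only [negLapPow_succ, ih, laplacian_sub (hφ.negLapPow j) (hψ.negLapPow j)]
    ring

lemma laplacian_const_mul_comp_smul_sub {φ : EuclideanSpace ℝ (Fin n) → ℝ}
    (hφ : ContDiff ℝ ∞ φ) (b a : ℝ) (z x : EuclideanSpace ℝ (Fin n)) :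
    laplacian (fun y => b * φ (a • (y - z))) x = b * a ^ 2 * laplacian φ (a • (x - z)) := by
  have h2 : (2 : WithTop ℕ∞) ≤ ∞ := by decide
  unfold laplacian
  rw [Finset.mul_sum]
  refine Finset.sum_congr rfl fun i _ => ?_
  have hs : ContDiff ℝ 2 (fun y => φ (a • y)) :=
    (hφ.of_le h2).comp (contDiff_const_smul a)
  have e1 : (fun y => b * φ (a • (y - z))) = b • (fun y => (fun w => φ (a • w)) (y - z)) := by
    funext y; simp
  have hs' : ContDiff ℝ 2 (fun y => (fun w => φ (a • w)) (y - z)) :=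
    hs.comp (contDiff_id.sub contDiff_const)
  rw [e1, iteratedFDeriv_const_smul_apply hs'.contDiffAt,
    iteratedFDeriv_comp_sub (f := fun w => φ (a • w)) 2 z x,
    iteratedFDeriv_comp_const_smul a (hφ.of_le h2)]
  simp [mul_assoc]

lemma negLapPow_const_mul_comp_smul_sub {φ : EuclideanSpace ℝ (Fin n) → ℝ}
    (hφ : ContDiff ℝ ∞ φ) (b a : ℝ) (z : EuclideanSpace ℝ (Fin n)) (j : ℕ) :
    negLapPow j (fun y => b * φ (a • (y - z)))
      = fun x => b * a ^ (2 * j) * negLapPow j φ (a • (x - z)) := by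
  induction j with
  | zero => simp [negLapPow_zero]
  | succ j ih =>
    funext x
    simp only [negLapPow_succ, ih]
    rw [laplacian_const_mul_comp_smul_sub (hφ.negLapPow j)]
    ring

lemma norm_iteratedFDeriv_laplacian_le {φ : EuclideanSpace ℝ (Fin n) → ℝ}
    (hφ : ContDiff ℝ ∞ φ) (i : ℕ) (x : EuclideanSpace ℝ (Fin n)) :
    ‖iteratedFDeriv ℝ i (laplacian φ) x‖ ≤ n * ‖iteratedFDeriv ℝ (i + 2) φ x‖ := by
  have hi : (i : WithTop ℕ∞) ≤ ∞ := by exact_mod_cast le_top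
  have h1 : ∀ v, ContDiff ℝ ∞ (fun y => fderiv ℝ φ y v) := fun v =>
    (hφ.fderiv_right (m := ∞) (by decide)).clm_apply contDiff_const
  have h2 : ∀ v, ContDiff ℝ ∞ (fun x => fderiv ℝ (fun y => fderiv ℝ φ y v) x v) := fun v =>
    ((h1 v).fderiv_right (m := ∞) (by decide)).clm_apply contDiff_const
  have e : laplacian φ = fun x => ∑ i : Fin n,
      fderiv ℝ (fun y => fderiv ℝ φ y (EuclideanSpace.single i 1)) x
        (EuclideanSpace.single i 1) := by
    funext x
    exact laplacian_eq_sum_fderiv (hφ.of_le (by decide)).contDiffAt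
  rw [e, iteratedFDeriv_fun_sum_apply fun j _ => ((h2 _).of_le hi).contDiffAt]
  have hle : ∀ j : Fin n, ‖iteratedFDeriv ℝ i (fun x =>
      fderiv ℝ (fun y => fderiv ℝ φ y (EuclideanSpace.single j 1)) x
        (EuclideanSpace.single j 1)) x‖ ≤ ‖iteratedFDeriv ℝ (i + 2) φ x‖ := by
    intro j
    have hfd : ∀ {ψ : EuclideanSpace ℝ (Fin n) → ℝ}, ContDiff ℝ ∞ ψ → ∀ l : ℕ,
        ‖iteratedFDeriv ℝ l (fun y => fderiv ℝ ψ y (EuclideanSpace.single j 1)) x‖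
          ≤ ‖iteratedFDeriv ℝ (l + 1) ψ x‖ := by
      intro ψ hψ l
      have := norm_iteratedFDeriv_clm_apply_const (c := EuclideanSpace.single j (1 : ℝ)) (n := l)
        (hψ.fderiv_right (m := ∞) (by decide)).contDiffAt (x := x) (by exact_mod_cast le_top)
      simpa [norm_iteratedFDeriv_fderiv] using this
    exact (hfd (h1 _) i).trans (hfd hφ (i + 1))
  calc ‖_‖ ≤ ∑ j : Fin n, ‖iteratedFDeriv ℝ (i + 2) φ x‖ := by
        exact norm_sum_le_of_le _ fun j _ => hle j
    _ = _ := by simp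

lemma norm_iteratedFDeriv_negLapPow_le {φ : EuclideanSpace ℝ (Fin n) → ℝ}
    (hφ : ContDiff ℝ ∞ φ) (j i : ℕ) (x : EuclideanSpace ℝ (Fin n)) :
    ‖iteratedFDeriv ℝ i (negLapPow j φ) x‖
      ≤ (n : ℝ) ^ j * ‖iteratedFDeriv ℝ (i + 2 * j) φ x‖ := by
  induction j generalizing i with
  | zero => simp [negLapPow_zero]
  | succ j ih =>
    rw [negLapPow_succ, show (fun x => -laplacian (negLapPow j φ) x) = -laplacian (negLapPow j φ)
      from rfl, iteratedFDeriv_neg_apply, norm_neg]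
    calc _ ≤ _ := norm_iteratedFDeriv_laplacian_le (hφ.negLapPow j) i x
      _ ≤ n * ((n : ℝ) ^ j * ‖iteratedFDeriv ℝ (i + 2 + 2 * j) φ x‖) := by gcongr; exact ih _
      _ = _ := by rw [show i + 2 + 2 * j = i + 2 * (j + 1) by ring]; ring

lemma abs_negLapPow_le {φ : EuclideanSpace ℝ (Fin n) → ℝ}
    (hφ : ContDiff ℝ ∞ φ) (j : ℕ) (x : EuclideanSpace ℝ (Fin n)) :
    |negLapPow j φ x| ≤ (n : ℝ) ^ j * ‖iteratedFDeriv ℝ (2 * j) φ x‖ := by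
  have h := norm_iteratedFDeriv_negLapPow_le hφ j 0 x
  rwa [norm_iteratedFDeriv_zero, Real.norm_eq_abs, zero_add] at h

end Laplacian

/-! ### Integration by parts -/

section IntegrationByParts

variable {n : ℕ}

lemma ContinuousOn.continuous_mul_of_tsupport_subset {w ψ : EuclideanSpace ℝ (Fin n) → ℝ}
    {U : Set (EuclideanSpace ℝ (Fin n))} (hU : IsOpen U) (hw : ContinuousOn w U)
    (hψ : Continuous ψ) (hs : tsupport ψ ⊆ U) : Continuous fun x => w x * ψ x := by
  refine continuous_iff_continuousAt.2 fun x => ?_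
  by_cases hx : x ∈ tsupport ψ
  · exact (hw.continuousAt (hU.mem_nhds (hs hx))).mul hψ.continuousAt
  · have : (fun x => w x * ψ x) =ᶠ[𝓝 x] fun _ => 0 := by
      filter_upwards [notMem_tsupport_iff_eventuallyEq.1 hx] with y hy
      simp [hy]
    exact continuousAt_const.congr this.symm

lemma ContinuousOn.integrable_mul_of_tsupport_subset {w ψ : EuclideanSpace ℝ (Fin n) → ℝ}
    {U : Set (EuclideanSpace ℝ (Fin n))} (hU : IsOpen U) (hw : ContinuousOn w U)
    (hψ : Continuous ψ) (hc : HasCompactSupport ψ) (hs : tsupport ψ ⊆ U) :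
    Integrable fun x => w x * ψ x :=
  (hw.continuous_mul_of_tsupport_subset hU hψ hs).integrable_of_hasCompactSupport hc.mul_left

lemma integral_laplacian_mul {w φ : EuclideanSpace ℝ (Fin n) → ℝ}
    {U : Set (EuclideanSpace ℝ (Fin n))} (hU : IsOpen U) (hw : ContDiffOn ℝ 2 w U)
    (hφ : ContDiff ℝ ∞ φ) (hc : HasCompactSupport φ) (hs : tsupport φ ⊆ U) :
    ∫ x, laplacian w x * φ x = ∫ x, w x * laplacian φ x := by
  have hφ1 : ∀ v, ContDiff ℝ ∞ (fun y => fderiv ℝ φ y v) := fun v =>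
    (hφ.fderiv_right (m := ∞) (by decide)).clm_apply contDiff_const
  have hφ2 : ∀ v, ContDiff ℝ ∞ (fun x => fderiv ℝ (fun y => fderiv ℝ φ y v) x v) := fun v =>
    ((hφ1 v).fderiv_right (m := ∞) (by decide)).clm_apply contDiff_const
  have hw1 : ∀ v, ContDiffOn ℝ 1 (fun y => fderiv ℝ w y v) U := fun v =>
    (hw.fderiv_of_isOpen hU (m := 1) (by norm_num)).clm_apply contDiffOn_const
  have hw2 : ∀ v, ContDiffOn ℝ 0 (fun x => fderiv ℝ (fun y => fderiv ℝ w y v) x v) U := fun v =>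
    ((hw1 v).fderiv_of_isOpen hU (m := 0) (by norm_num)).clm_apply contDiffOn_const
  have hs1 : ∀ v, tsupport (fun y => fderiv ℝ φ y v) ⊆ tsupport φ := tsupport_fderiv_apply_subset ℝ
  have hs2 : ∀ v, tsupport (fun x => fderiv ℝ (fun y => fderiv ℝ φ y v) x v) ⊆ tsupport φ :=
    fun v => (tsupport_fderiv_apply_subset ℝ v).trans (hs1 v)
  have hc1 : ∀ v, HasCompactSupport (fun y => fderiv ℝ φ y v) := fun v =>
    hc.of_isClosed_subset (isClosed_tsupport _) (hs1 v)
  have hc2 : ∀ v, HasCompactSupport (fun x => fderiv ℝ (fun y => fderiv ℝ φ y v) x v) := fun v =>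
    hc.of_isClosed_subset (isClosed_tsupport _) (hs2 v)
  have hd0 : ∀ x ∈ U, DifferentiableAt ℝ w x := fun x hx =>
    ((hw x hx).contDiffAt (hU.mem_nhds hx)).differentiableAt (by norm_num)
  have hd1 : ∀ v, ∀ x ∈ U, DifferentiableAt ℝ (fun y => fderiv ℝ w y v) x := fun v x hx =>
    ((hw1 v x hx).contDiffAt (hU.mem_nhds hx)).differentiableAt (by norm_num)
  have i20 := fun v => (hw2 v).continuousOn.integrable_mul_of_tsupport_subset hU hφ.continuous hc hs
  have i11 := fun v => (hw1 v).continuousOn.integrable_mul_of_tsupport_subset hU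
    (hφ1 v).continuous (hc1 v) ((hs1 v).trans hs)
  have i10 := fun v => (hw1 v).continuousOn.integrable_mul_of_tsupport_subset hU
    hφ.continuous hc hs
  have i01 := fun v => hw.continuousOn.integrable_mul_of_tsupport_subset hU
    (hφ1 v).continuous (hc1 v) ((hs1 v).trans hs)
  have i02 := fun v => hw.continuousOn.integrable_mul_of_tsupport_subset hU
    (hφ2 v).continuous (hc2 v) ((hs2 v).trans hs)
  have key : ∀ v, ∫ x, fderiv ℝ (fun y => fderiv ℝ w y v) x v * φ x
      = ∫ x, w x * fderiv ℝ (fun y => fderiv ℝ φ y v) x v := by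
    intro v
    have p1 := integral_mul_fderiv_eq_neg_fderiv_mul_of_integrable (v := v) (i11 v) (i02 v) (i01 v)
      (fun x hx => hd0 x (hs (hs1 v hx)))
      (fun x _ => ((hφ1 v).differentiable (by decide)).differentiableAt)
    have p2 := integral_mul_fderiv_eq_neg_fderiv_mul_of_integrable (v := v) (i20 v) (i11 v) (i10 v)
      (fun x hx => hd1 v x (hs hx))
      (fun x _ => (hφ.differentiable (by decide)).differentiableAt)
    rw [p1, p2, neg_neg]
  calc ∫ x, laplacian w x * φ x
      = ∫ x, ∑ i : Fin n, fderiv ℝ (fun y => fderiv ℝ w y (EuclideanSpace.single i 1)) x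
        (EuclideanSpace.single i 1) * φ x := by
        congr 1 with x
        by_cases hx : x ∈ tsupport φ
        · rw [laplacian_eq_sum_fderiv ((hw x (hs hx)).contDiffAt (hU.mem_nhds (hs hx))),
            Finset.sum_mul]
        · simp [image_eq_zero_of_notMem_tsupport hx]
    _ = ∫ x, ∑ i : Fin n, w x * fderiv ℝ (fun y => fderiv ℝ φ y (EuclideanSpace.single i 1)) x
        (EuclideanSpace.single i 1) := by
        rw [integral_finsetSum _ fun i _ => i20 _, integral_finsetSum _ fun i _ => i02 _]
        exact Finset.sum_congr rfl fun i _ => key _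
    _ = _ := by
        congr 1 with x
        rw [laplacian_eq_sum_fderiv (hφ.of_le (by decide)).contDiffAt, Finset.mul_sum]

lemma integral_negLapPow_mul {u φ : EuclideanSpace ℝ (Fin n) → ℝ}
    {U : Set (EuclideanSpace ℝ (Fin n))} (hU : IsOpen U) {j : ℕ}
    (hu : ContDiffOn ℝ ((2 * j : ℕ) : WithTop ℕ∞) u U)
    (hφ : ContDiff ℝ ∞ φ) (hc : HasCompactSupport φ) (hs : tsupport φ ⊆ U) :
    ∫ x, negLapPow j u x * φ x = ∫ x, u x * negLapPow j φ x := by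
  induction j generalizing φ with
  | zero => rfl
  | succ j ih =>
    have hw : ContDiffOn ℝ 2 (negLapPow j u) U :=
      ContDiffOn.negLapPow_of_isOpen (l := 2) hU (by simpa [mul_add] using hu)
    have hs' : tsupport (fun x => -laplacian φ x) ⊆ tsupport φ :=
      tsupport_negLapPow_subset φ 1
    rw [negLapPow_succ_eq_negLapPow j φ, ← ih (hu.of_le (by gcongr; simp)) hφ.laplacian.neg
      (hc.of_isClosed_subset (isClosed_tsupport _) hs') (hs'.trans hs), negLapPow_succ]
    simp only [neg_mul, mul_neg, integral_neg]
    rw [integral_laplacian_mul hU hw hφ hc hs]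

end IntegrationByParts

/-! ### Testing against functions that do not vanish at the origin -/

section Origin

variable {n : ℕ}

lemma exists_abs_negLapPow_mul_comp_smul_le {φ η : EuclideanSpace ℝ (Fin n) → ℝ}
    (hφ : ContDiff ℝ ∞ φ) (hφc : HasCompactSupport φ) (hη : ContDiff ℝ ∞ η)
    (hηc : HasCompactSupport η) (m : ℕ) :
    ∃ C : ℝ, 0 ≤ C ∧ ∀ a : ℝ, 1 ≤ a → ∀ x,
      |negLapPow m (fun y => φ y * η (a • y)) x| ≤ C * a ^ (2 * m) := by
  have hN : ∀ i : ℕ, (i : WithTop ℕ∞) ≤ ∞ := fun i => by exact_mod_cast le_top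
  choose A hA using fun i : ℕ => (hφ.continuous_iteratedFDeriv (hN i)).bounded_above_of_compact_support
    (hφc.iteratedFDeriv i)
  choose B hB using fun i : ℕ => (hη.continuous_iteratedFDeriv (hN i)).bounded_above_of_compact_support
    (hηc.iteratedFDeriv i)
  have hA0 : ∀ i, 0 ≤ A i := fun i => (norm_nonneg _).trans (hA i 0)
  have hB0 : ∀ i, 0 ≤ B i := fun i => (norm_nonneg _).trans (hB i 0)
  refine ⟨(n : ℝ) ^ m * ∑ i ∈ Finset.range (2 * m + 1),
    ((2 * m).choose i : ℝ) * A i * B (2 * m - i), ?_, fun a ha x => ?_⟩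
  · exact mul_nonneg (by positivity) (Finset.sum_nonneg fun i _ =>
      mul_nonneg (mul_nonneg (by positivity) (hA0 i)) (hB0 _))
  have hηa : ContDiff ℝ ∞ (fun y => η (a • y)) := hη.comp (contDiff_const_smul a)
  refine (abs_negLapPow_le (hφ.mul hηa) m x).trans ?_
  rw [mul_assoc, Finset.sum_mul]
  gcongr
  refine (norm_iteratedFDeriv_mul_le hφ hηa x (hN _)).trans (Finset.sum_le_sum fun i hi => ?_)
  have hB' : ‖iteratedFDeriv ℝ (2 * m - i) (fun y => η (a • y)) x‖ ≤ B (2 * m - i) * a ^ (2 * m) := by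
    rw [iteratedFDeriv_comp_const_smul a (hη.of_le (hN _)), norm_smul, norm_pow, Real.norm_eq_abs,
      abs_of_nonneg (by linarith), mul_comm]
    gcongr
    · exact hB0 _
    · exact hB _ _
    · exact Nat.sub_le _ _
  calc _ ≤ ((2 * m).choose i : ℝ) * A i * (B (2 * m - i) * a ^ (2 * m)) := by
        have := hA0 i
        gcongr
        exact hA i x
    _ = _ := by ring

/-- If `2 * m < n`, then the origin is invisible to the distributional inequality
`(-Δ)^m u * φ ≥ G`, provided that `u` is continuous. -/
lemma integral_le_integral_mul_negLapPow {u φ G : EuclideanSpace ℝ (Fin n) → ℝ} {m : ℕ}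
    (hm : 2 * m < n) (hu : Continuous u)
    (hus : ContDiffOn ℝ ((2 * m : ℕ) : WithTop ℕ∞) u {(0 : EuclideanSpace ℝ (Fin n))}ᶜ)
    (hφ : ContDiff ℝ ∞ φ) (hφc : HasCompactSupport φ) (hG : Continuous G)
    (hGc : HasCompactSupport G) (hle : ∀ x, x ≠ 0 → G x ≤ negLapPow m u x * φ x) :
    ∫ x, G x ≤ ∫ x, u x * negLapPow m φ x := by
  let η : ContDiffBump (0 : EuclideanSpace ℝ (Fin n)) := ⟨1, 2, one_pos, one_lt_two⟩
  have hη : ContDiff ℝ ∞ η := η.contDiff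
  obtain ⟨C, hC0, hC⟩ := exists_abs_negLapPow_mul_comp_smul_le hφ hφc hη η.hasCompactSupport m
  obtain ⟨M, hM⟩ := hG.bounded_above_of_compact_support hGc
  obtain ⟨L, hL⟩ := (isCompact_closedBall (0 : EuclideanSpace ℝ (Fin n)) 2).exists_bound_of_continuousOn
    hu.continuousOn
  have hM0 : 0 ≤ M := (norm_nonneg _).trans (hM 0)
  have hL0 : 0 ≤ L := (norm_nonneg _).trans (hL 0 (by simp))
  set V : ℝ := volume.real (Metric.ball (0 : EuclideanSpace ℝ (Fin n)) 1)
  set K : ℝ := (M + L * C) * (2 ^ n * V)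
  have hK0 : 0 ≤ K := by positivity
  have main : ∀ δ : ℝ, 0 < δ → δ ≤ 1 → ∫ x, G x ≤ (∫ x, u x * negLapPow m φ x) + K * δ := by
    intro δ hδ hδ1
    have ha : 1 ≤ δ⁻¹ := (one_le_inv₀ hδ).2 hδ1
    set ηδ : EuclideanSpace ℝ (Fin n) → ℝ := fun y => η (δ⁻¹ • y) with hηδ
    have hηδs : ContDiff ℝ ∞ ηδ := hη.comp (contDiff_const_smul _)
    have hout : ∀ y ∉ Metric.closedBall (0 : EuclideanSpace ℝ (Fin n)) (2 * δ), ηδ y = 0 := by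
      intro y hy
      refine η.zero_of_le_dist ?_
      rw [Metric.mem_closedBall, not_le, dist_zero_right] at hy
      rw [dist_zero_right, norm_smul, norm_inv, Real.norm_eq_abs, abs_of_pos hδ]
      rw [inv_mul_eq_div]
      exact (le_div_iff₀ hδ).2 hy.le
    have hin : ∀ y ∈ Metric.ball (0 : EuclideanSpace ℝ (Fin n)) δ, ηδ y = 1 := by
      intro y hy
      refine η.one_of_mem_closedBall ?_
      rw [Metric.mem_ball, dist_zero_right] at hy
      rw [Metric.mem_closedBall, dist_zero_right, norm_smul, norm_inv, Real.norm_eq_abs,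
        abs_of_pos hδ, inv_mul_eq_div]
      exact (div_le_one hδ).2 hy.le
    have hφη : ContDiff ℝ ∞ (fun y => φ y * ηδ y) := hφ.mul hηδs
    have hφηc : HasCompactSupport (fun y => φ y * ηδ y) := hφc.mul_right
    set ψ : EuclideanSpace ℝ (Fin n) → ℝ := fun y => φ y - φ y * ηδ y with hψ
    have hψs : ContDiff ℝ ∞ ψ := hφ.sub hφη
    have hψc : HasCompactSupport ψ := hφc.sub hφηc
    have hψ0 : tsupport ψ ⊆ {(0 : EuclideanSpace ℝ (Fin n))}ᶜ := by
      intro y hy h0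
      rw [mem_singleton_iff] at h0
      subst h0
      refine notMem_tsupport_iff_eventuallyEq.2 ?_ hy
      filter_upwards [Metric.ball_mem_nhds _ hδ] with y hy
      simp [hψ, hin y hy]
    have hus' : ContinuousOn (negLapPow m u) {(0 : EuclideanSpace ℝ (Fin n))}ᶜ :=
      (ContDiffOn.negLapPow_of_isOpen (l := 0) isOpen_compl_singleton hus).continuousOn
    have iw := hus'.integrable_mul_of_tsupport_subset isOpen_compl_singleton hψs.continuous hψc hψ0
    have iG : Integrable G := hG.integrable_of_hasCompactSupport hGc
    have iGη : Integrable fun x => G x * ηδ x :=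
      (hG.mul hηδs.continuous).integrable_of_hasCompactSupport hGc.mul_right
    have iu : ∀ {χ : EuclideanSpace ℝ (Fin n) → ℝ}, ContDiff ℝ ∞ χ → HasCompactSupport χ →
        Integrable fun x => u x * negLapPow m χ x := fun {χ} h hc =>
      (hu.mul (h.negLapPow m).continuous).integrable_of_hasCompactSupport
        (HasCompactSupport.mul_left
          (hc.of_isClosed_subset (isClosed_tsupport _) (tsupport_negLapPow_subset χ m)))
    have h1 : ∫ x, (G x - G x * ηδ x) ≤ ∫ x, negLapPow m u x * ψ x := by
      refine integral_mono (iG.sub iGη) iw fun x => ?_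
      by_cases hx : x = 0
      · simp [hψ, hx, hin 0 (Metric.mem_ball_self hδ)]
      · have := mul_le_mul_of_nonneg_right (hle x hx) (sub_nonneg.2 (η.le_one (x := δ⁻¹ • x)))
        simp only [hψ, hηδ]
        linarith
    rw [integral_negLapPow_mul isOpen_compl_singleton hus hψs hψc hψ0, hψ,
      negLapPow_sub hφ hφη, integral_sub iG iGη] at h1
    simp only [mul_sub] at h1
    rw [integral_sub (iu hφ hφc) (iu hφη hφηc)] at h1
    set F : EuclideanSpace ℝ (Fin n) → ℝ :=
      fun x => G x * ηδ x - u x * negLapPow m (fun y => φ y * ηδ y) x with hF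
    have hF0 : ∀ x ∉ Metric.closedBall (0 : EuclideanSpace ℝ (Fin n)) (2 * δ), F x = 0 := by
      intro x hx
      have : x ∉ tsupport (fun y => φ y * ηδ y) := by
        refine fun h => hx (closure_minimal (fun y hy => ?_) Metric.isClosed_closedBall h)
        by_contra h'
        exact hy (by simp [hout y h'])
      have h2 : negLapPow m (fun y => φ y * ηδ y) x = 0 :=
        image_eq_zero_of_notMem_tsupport fun h => this (tsupport_negLapPow_subset _ m h)
      simp [hF, h2, hout x hx]
    have hFb : ∀ x ∈ Metric.closedBall (0 : EuclideanSpace ℝ (Fin n)) (2 * δ),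
        ‖F x‖ ≤ (M + L * C) * δ⁻¹ ^ (2 * m) := by
      intro x hx
      have hx2 : x ∈ Metric.closedBall (0 : EuclideanSpace ℝ (Fin n)) 2 :=
        Metric.closedBall_subset_closedBall (by linarith) hx
      have e1 : ‖G x * ηδ x‖ ≤ M * δ⁻¹ ^ (2 * m) := by
        rw [norm_mul]
        have : ‖ηδ x‖ ≤ δ⁻¹ ^ (2 * m) := by
          rw [Real.norm_eq_abs, abs_of_nonneg η.nonneg]
          exact η.le_one.trans (one_le_pow₀ ha)
        gcongr
        exact hM x
      have e2 : ‖u x * negLapPow m (fun y => φ y * ηδ y) x‖ ≤ L * (C * δ⁻¹ ^ (2 * m)) := by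
        rw [norm_mul]
        gcongr
        · exact hL x hx2
        · exact hC _ ha x
      calc ‖F x‖ ≤ _ := norm_sub_le _ _
        _ ≤ _ := add_le_add e1 e2
        _ = _ := by ring
    have hFI : ∫ x, F x ≤ K * δ := by
      rw [← setIntegral_eq_integral_of_forall_compl_eq_zero hF0]
      refine (le_abs_self _).trans ((norm_setIntegral_le_of_norm_le_const
        measure_closedBall_lt_top hFb).trans ?_)
      rw [Measure.addHaar_real_closedBall _ _ (by positivity), finrank_euclideanSpace_fin, mul_pow]
      calc (M + L * C) * δ⁻¹ ^ (2 * m) * (2 ^ n * δ ^ n * V)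
          = K * (δ⁻¹ ^ (2 * m) * δ ^ n) := by ring
        _ ≤ K * δ := by
          gcongr
          obtain ⟨r, rfl⟩ := Nat.exists_eq_add_of_lt hm
          rw [pow_succ, pow_add, ← mul_assoc, ← mul_assoc, ← mul_pow, inv_mul_cancel₀ hδ.ne',
            one_pow, one_mul]
          exact mul_le_of_le_one_left hδ.le (pow_le_one₀ hδ.le hδ1)
    rw [hF, integral_sub iGη (iu hφη hφηc)] at hFI
    linarith
  refine le_of_forall_pos_le_add fun ε hε => ?_
  have hpos : 0 < min 1 (ε / (K + 1)) := by positivity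
  refine (main _ hpos (min_le_left _ _)).trans ?_
  gcongr
  calc K * min 1 (ε / (K + 1)) ≤ (K + 1) * (ε / (K + 1)) := by
        gcongr
        · linarith
        · exact min_le_right _ _
    _ = ε := by field_simp

end Origin

/-! ### Integral growth of positive solutions -/

section Growth

variable {n : ℕ}

lemma exists_laplacian_pow_mul_eq {ζ h : EuclideanSpace ℝ (Fin n) → ℝ} (hζ : ContDiff ℝ ∞ ζ)
    (hh : ContDiff ℝ ∞ h) (a : ℕ) :
    ∃ g : EuclideanSpace ℝ (Fin n) → ℝ, ContDiff ℝ ∞ g ∧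
      laplacian (fun y => ζ y ^ (a + 2) * h y) = fun x => ζ x ^ a * g x := by
  have hD : ∀ {χ : EuclideanSpace ℝ (Fin n) → ℝ} (v : EuclideanSpace ℝ (Fin n)),
      ContDiff ℝ ∞ χ → ContDiff ℝ ∞ (fun y => fderiv ℝ χ y v) := fun {χ} v hχ =>
    (hχ.fderiv_right (m := ∞) (by decide)).clm_apply contDiff_const
  let T : ℕ → EuclideanSpace ℝ (Fin n) → (EuclideanSpace ℝ (Fin n) → ℝ) →
      EuclideanSpace ℝ (Fin n) → ℝ := fun b v χ x =>
    ((b : ℝ) + 1) * fderiv ℝ ζ x v * χ x + ζ x * fderiv ℝ χ x v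
  have hT : ∀ b v {χ : EuclideanSpace ℝ (Fin n) → ℝ}, ContDiff ℝ ∞ χ → ContDiff ℝ ∞ (T b v χ) :=
    fun b v {χ} hχ => ((contDiff_const.mul (hD v hζ)).mul hχ).add (hζ.mul (hD v hχ))
  have key : ∀ b v {χ : EuclideanSpace ℝ (Fin n) → ℝ}, ContDiff ℝ ∞ χ →
      (fun x => fderiv ℝ (fun y => ζ y ^ (b + 1) * χ y) x v) = fun x => ζ x ^ b * T b v χ x := by
    intro b v χ hχ
    funext x
    have d1 : HasFDerivAt ζ (fderiv ℝ ζ x) x :=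
      ((hζ.differentiable (by decide)).differentiableAt).hasFDerivAt
    have d2 : HasFDerivAt χ (fderiv ℝ χ x) x :=
      ((hχ.differentiable (by decide)).differentiableAt).hasFDerivAt
    rw [((d1.pow (b + 1)).fun_mul d2).fderiv]
    simp [T]
    ring
  refine ⟨fun x => ∑ i : Fin n, T a (EuclideanSpace.single i 1)
    (T (a + 1) (EuclideanSpace.single i 1) h) x, ContDiff.sum fun i _ => hT _ _ (hT _ _ hh), ?_⟩
  funext x
  rw [laplacian_eq_sum_fderiv (((hζ.pow _).mul hh).of_le (by decide)).contDiffAt, Finset.mul_sum]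
  refine Finset.sum_congr rfl fun i _ => ?_
  rw [key (a + 1) _ hh]
  exact congrFun (key a _ (hT _ _ hh)) x

lemma exists_negLapPow_pow_eq {ζ : EuclideanSpace ℝ (Fin n) → ℝ} (hζ : ContDiff ℝ ∞ ζ)
    (m l : ℕ) :
    ∃ g : EuclideanSpace ℝ (Fin n) → ℝ, ContDiff ℝ ∞ g ∧
      negLapPow m (fun y => ζ y ^ (l + 2 * m)) = fun x => ζ x ^ l * g x := by
  induction m generalizing l with
  | zero => exact ⟨fun _ => 1, contDiff_const, by simp [negLapPow_zero]⟩
  | succ m ih =>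
    obtain ⟨g, hg, e⟩ := ih (l + 2)
    obtain ⟨g', hg', e'⟩ := exists_laplacian_pow_mul_eq hζ hg l
    refine ⟨fun x => -g' x, hg'.neg, ?_⟩
    rw [show l + 2 * (m + 1) = l + 2 + 2 * m by ring, negLapPow_succ, e, e']
    simp

lemma exists_mul_le_mul_rpow_add {p c : ℝ} (hp : 1 < p) (hc : 0 < c) (H : ℝ) :
    ∃ K : ℝ, 0 ≤ K ∧ ∀ t : ℝ, 0 ≤ t → H * t ≤ c * t ^ p + K := by
  set T : ℝ := (|H| / c) ^ (1 / (p - 1)) with hT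
  have hT0 : 0 ≤ T := by positivity
  refine ⟨|H| * T, by positivity, fun t ht => ?_⟩
  have h1 : H * t ≤ |H| * t := by gcongr; exact le_abs_self H
  have htp : 0 ≤ t ^ p := Real.rpow_nonneg ht p
  rcases le_total t T with h | h
  · have : |H| * t ≤ |H| * T := by gcongr
    have : 0 ≤ c * t ^ p := by positivity
    linarith
  · have h2 : |H| / c ≤ t ^ (p - 1) := by
      have := Real.rpow_le_rpow hT0 h (by linarith : 0 ≤ p - 1)
      rwa [hT, ← Real.rpow_mul (by positivity), one_div_mul_cancel (by linarith),
        Real.rpow_one] at this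
    have h3 : t ^ p = t ^ (p - 1) * t := by
      rcases ht.eq_or_lt with rfl | ht
      · rw [Real.zero_rpow (by linarith)]; simp
      · rw [← Real.rpow_add_one ht.ne']; simp
    rw [div_le_iff₀ hc] at h2
    have : |H| * t ≤ t ^ (p - 1) * c * t := by gcongr
    have : 0 ≤ |H| * T := by positivity
    rw [h3]
    linarith

lemma exists_setIntegral_ball_le {k : ℕ} (hn : 2 * k < n) {σ p c : ℝ}
    (hσ0 : 0 ≤ σ) (hσk : σ < 2 * (k : ℝ)) (hp : 1 < p) (hc : 0 < c)
    {u : EuclideanSpace ℝ (Fin n) → ℝ} (hupos : ∀ x, 0 < u x) (hucont : Continuous u)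
    (husmooth : ContDiffOn ℝ ((2 * k : ℕ) : WithTop ℕ∞) u {(0 : EuclideanSpace ℝ (Fin n))}ᶜ)
    (hineq : ∀ x : EuclideanSpace ℝ (Fin n), x ≠ 0 →
      c * ‖x‖ ^ (-σ) * u x ^ p ≤ negLapPow k u x) :
    ∃ C : ℝ, 0 ≤ C ∧ ∀ R : ℝ, 1 ≤ R →
      ∫ x in Metric.ball (0 : EuclideanSpace ℝ (Fin n)) (R / 2), u x ≤ C * R ^ n := by
  let ζ : ContDiffBump (0 : EuclideanSpace ℝ (Fin n)) := ⟨1 / 2, 1, by norm_num, by norm_num⟩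
  have hζ : ContDiff ℝ ∞ ζ := ζ.contDiff
  obtain ⟨l, hl⟩ := exists_nat_ge (2 * (k : ℝ) / (p - 1) + 1)
  have hp1 : 0 < p - 1 := by linarith
  have hl1 : 1 ≤ l := by
    have : 0 ≤ 2 * (k : ℝ) / (p - 1) := by positivity
    exact_mod_cast (by linarith : (1 : ℝ) ≤ l)
  have hlp : ((l + 2 * k : ℕ) : ℝ) ≤ l * p := by
    have : 2 * (k : ℝ) / (p - 1) ≤ l := by linarith
    rw [div_le_iff₀ hp1] at this
    push_cast
    linarith
  obtain ⟨g, hg, eg⟩ := exists_negLapPow_pow_eq hζ k l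
  obtain ⟨H, hH⟩ := (isCompact_closedBall (0 : EuclideanSpace ℝ (Fin n)) 1).exists_bound_of_continuousOn
    hg.continuous.continuousOn
  obtain ⟨K, hK0, hK⟩ := exists_mul_le_mul_rpow_add hp (half_pos hc) H
  set φ : EuclideanSpace ℝ (Fin n) → ℝ := fun y => ζ y ^ (l + 2 * k) with hφdef
  have hφ : ContDiff ℝ ∞ φ := hζ.pow _
  set V : ℝ := volume.real (Metric.ball (0 : EuclideanSpace ℝ (Fin n)) 1)
  refine ⟨2 * K * V / c + V, by positivity, fun R hR => ?_⟩
  have hR0 : 0 < R := by linarith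
  have hzero : ∀ x ∉ Metric.ball (0 : EuclideanSpace ℝ (Fin n)) R, ζ (R⁻¹ • x) = 0 := by
    intro x hx
    refine ζ.zero_of_le_dist ?_
    rw [Metric.mem_ball, not_lt, dist_zero_right] at hx
    rw [dist_zero_right, norm_smul, norm_inv, Real.norm_eq_abs, abs_of_pos hR0, inv_mul_eq_div]
    exact (one_le_div hR0).2 hx
  set φR : EuclideanSpace ℝ (Fin n) → ℝ := fun x => φ (R⁻¹ • x) with hφR
  have hφRs : ContDiff ℝ ∞ φR := hφ.comp (contDiff_const_smul _)
  have hφR0 : ∀ x, 0 ≤ φR x := fun x => pow_nonneg ζ.nonneg _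
  have hφRzero : ∀ x ∉ Metric.ball (0 : EuclideanSpace ℝ (Fin n)) R, φR x = 0 := fun x hx => by
    simp only [hφR, hφdef, hzero x hx]
    exact zero_pow (by omega)
  have hφRc : HasCompactSupport φR :=
    HasCompactSupport.intro (isCompact_closedBall 0 R) fun x hx =>
      hφRzero x fun h => hx (Metric.ball_subset_closedBall h)
  have eR : negLapPow k φR = fun x => R⁻¹ ^ (2 * k) * (ζ (R⁻¹ • x) ^ l * g (R⁻¹ • x)) := by
    have := negLapPow_const_mul_comp_smul_sub hφ 1 R⁻¹ 0 k
    simp only [one_mul, sub_zero] at this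
    rw [hφR, this, eg]
  have hup : Continuous fun x => u x ^ p := hucont.rpow_const fun x => Or.inl (hupos x).ne'
  have hup0 : ∀ x, 0 ≤ u x ^ p := fun x => Real.rpow_nonneg (hupos x).le p
  set I : ℝ := ∫ x, u x ^ p * φR x with hI
  have iI : Integrable fun x => u x ^ p * φR x :=
    (hup.mul hφRs.continuous).integrable_of_hasCompactSupport hφRc.mul_left
  have hI0 : 0 ≤ I := integral_nonneg fun x => mul_nonneg (hup0 x) (hφR0 x)
  have hlow : c * R ^ (-σ) * I ≤ ∫ x, u x * negLapPow k φR x := by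
    rw [hI, ← integral_const_mul]
    refine integral_le_integral_mul_negLapPow hn hucont husmooth hφRs hφRc
      (continuous_const.mul (hup.mul hφRs.continuous)) (hφRc.mul_left.mul_left) fun x hx => ?_
    by_cases hxR : x ∈ Metric.ball (0 : EuclideanSpace ℝ (Fin n)) R
    · rw [Metric.mem_ball, dist_zero_right] at hxR
      rw [← mul_assoc]
      refine mul_le_mul_of_nonneg_right (le_trans ?_ (hineq x hx)) (hφR0 x)
      have : R ^ (-σ) ≤ ‖x‖ ^ (-σ) :=
        Real.rpow_le_rpow_of_nonpos (norm_pos_iff.2 hx) hxR.le (by linarith)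
      have := hup0 x
      gcongr
    · simp [hφRzero x hxR]
  set B : Set (EuclideanSpace ℝ (Fin n)) := Metric.ball 0 R with hB
  have hBm : MeasurableSet B := Metric.isOpen_ball.measurableSet
  have hBV : volume.real B = R ^ n * V := by
    rw [hB, measureReal_def, Measure.addHaar_ball_of_pos _ _ hR0, finrank_euclideanSpace_fin,
      ENNReal.toReal_mul, ENNReal.toReal_ofReal (by positivity)]
    rfl
  have iB : Integrable (B.indicator fun _ => K) :=
    (integrable_indicator_iff hBm).2 (integrableOn_const Metric.isBounded_ball.measure_lt_top.ne)
  have hupper : ∫ x, u x * negLapPow k φR x ≤ R⁻¹ ^ (2 * k) * (c / 2 * I + K * (R ^ n * V)) := by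
    have e : R⁻¹ ^ (2 * k) * (c / 2 * I + K * (R ^ n * V)) = ∫ x, R⁻¹ ^ (2 * k) *
        (c / 2 * (u x ^ p * φR x) + B.indicator (fun _ => K) x) := by
      rw [integral_const_mul, integral_add (iI.const_mul _) iB, integral_const_mul,
        integral_indicator_const _ hBm, hBV, smul_eq_mul, mul_comm K]
    rw [e]
    refine integral_mono ?_ (((iI.const_mul _).add iB).const_mul _) fun x => ?_
    · exact (hucont.mul (hφRs.negLapPow k).continuous).integrable_of_hasCompactSupport
        (HasCompactSupport.mul_left
          (hφRc.of_isClosed_subset (isClosed_tsupport _) (tsupport_negLapPow_subset φR k)))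
    · simp only [eR]
      rw [mul_left_comm]
      refine mul_le_mul_of_nonneg_left ?_ (by positivity)
      by_cases hxR : x ∈ B
      · rw [indicator_of_mem hxR]
        set z := ζ (R⁻¹ • x) with hz
        have hz0 : 0 ≤ z := ζ.nonneg
        have hz1 : z ≤ 1 := ζ.le_one
        have hgH : g (R⁻¹ • x) ≤ H := by
          refine (le_abs_self _).trans (hH _ ?_)
          rw [hB, Metric.mem_ball, dist_zero_right] at hxR
          rw [Metric.mem_closedBall, dist_zero_right, norm_smul, norm_inv, Real.norm_eq_abs,
            abs_of_pos hR0, inv_mul_eq_div]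
          exact (div_le_one hR0).2 hxR.le
        have ht : 0 ≤ u x * z ^ l := mul_nonneg (hupos x).le (pow_nonneg hz0 _)
        have hzp : (z ^ l) ^ p ≤ z ^ (l + 2 * k) := by
          rw [← Real.rpow_natCast, ← Real.rpow_mul hz0, ← Real.rpow_natCast z (l + 2 * k)]
          exact Real.rpow_le_rpow_of_exponent_ge' hz0 hz1 (by positivity) hlp
        calc u x * (z ^ l * g (R⁻¹ • x)) = g (R⁻¹ • x) * (u x * z ^ l) := by ring
          _ ≤ H * (u x * z ^ l) := by gcongr
          _ ≤ c / 2 * (u x * z ^ l) ^ p + K := hK _ ht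
          _ = c / 2 * (u x ^ p * (z ^ l) ^ p) + K := by
            rw [Real.mul_rpow (hupos x).le (pow_nonneg hz0 _)]
          _ ≤ c / 2 * (u x ^ p * φR x) + K := by
            have := hup0 x
            have : (z ^ l) ^ p ≤ φR x := hzp
            gcongr
      · rw [indicator_of_notMem hxR, hzero x hxR, hφRzero x hxR, zero_pow (by omega)]
        simp
  have hRσ : R⁻¹ ^ (2 * k) ≤ R ^ (-σ) := by
    rw [inv_pow, ← Real.rpow_natCast, ← Real.rpow_neg hR0.le]
    refine Real.rpow_le_rpow_of_exponent_le hR ?_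
    push_cast
    linarith
  have hIle : c * I ≤ c / 2 * I + K * (R ^ n * V) := by
    have hpos : 0 < R ^ (-σ) := Real.rpow_pos_of_pos hR0 _
    have h0 : 0 ≤ c / 2 * I + K * (R ^ n * V) := by positivity
    have := (hlow.trans hupper).trans (mul_le_mul_of_nonneg_right hRσ h0)
    rw [mul_right_comm, mul_comm] at this
    exact le_of_mul_le_mul_left this hpos
  have hI2 : I ≤ 2 * K * V / c * R ^ n := by
    rw [div_mul_eq_mul_div, le_div_iff₀ hc]
    linarith
  set B' : Set (EuclideanSpace ℝ (Fin n)) := Metric.ball 0 (R / 2) with hB'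
  have hB'm : MeasurableSet B' := Metric.isOpen_ball.measurableSet
  have hB'B : B' ⊆ B := Metric.ball_subset_ball (by linarith)
  have hB'V : volume.real B' ≤ R ^ n * V := by
    rw [← hBV]
    exact measureReal_mono hB'B Metric.isBounded_ball.measure_lt_top.ne
  have i1 : IntegrableOn (fun _ => (1 : ℝ)) B' :=
    integrableOn_const Metric.isBounded_ball.measure_lt_top.ne
  calc ∫ x in B', u x ≤ ∫ x in B', (u x ^ p * φR x + 1) := by
        refine setIntegral_mono_on ?_ (iI.integrableOn.add i1) hB'm fun x hx => ?_
        · exact (hucont.continuousOn.integrableOn_compact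
            (isCompact_closedBall 0 (R / 2))).mono_set Metric.ball_subset_closedBall
        · have : φR x = 1 := by
            have : ζ (R⁻¹ • x) = 1 := by
              refine ζ.one_of_mem_closedBall ?_
              rw [hB', Metric.mem_ball, dist_zero_right] at hx
              rw [Metric.mem_closedBall, dist_zero_right, norm_smul, norm_inv, Real.norm_eq_abs,
                abs_of_pos hR0, inv_mul_eq_div]
              change ‖x‖ / R ≤ 1 / 2
              exact (div_le_iff₀ hR0).2 (by linarith)
            simp only [hφR, hφdef, this, one_pow]
          rw [this, mul_one]
          rcases le_total (u x) 1 with h | h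
          · linarith [hup0 x]
          · linarith [Real.self_le_rpow_of_one_le h hp.le]
    _ = (∫ x in B', u x ^ p * φR x) + volume.real B' := by
        rw [integral_add iI.integrableOn i1]
        simp
    _ ≤ I + R ^ n * V := by
        refine add_le_add (setIntegral_le_integral iI (Eventually.of_forall fun x =>
          mul_nonneg (hup0 x) (hφR0 x))) hB'V
    _ ≤ (2 * K * V / c + V) * R ^ n := by linarith

end Growth

/-! ### Radial test functions -/

section Radial

variable {n : ℕ}

lemma laplacian_comp_norm_sq {F F₁ F₂ : ℝ → ℝ} (hF : ContDiff ℝ 2 F)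
    (h1 : ∀ s, HasDerivAt F (F₁ s) s) (h2 : ∀ s, HasDerivAt F₁ (F₂ s) s)
    (x : EuclideanSpace ℝ (Fin n)) :
    laplacian (fun y : EuclideanSpace ℝ (Fin n) => F (‖y‖ ^ 2)) x
      = 4 * ‖x‖ ^ 2 * F₂ (‖x‖ ^ 2) + 2 * n * F₁ (‖x‖ ^ 2) := by
  have hN : ∀ y : EuclideanSpace ℝ (Fin n),
      HasFDerivAt (fun y : EuclideanSpace ℝ (Fin n) => ‖y‖ ^ 2) (2 • innerSL ℝ y) y :=
    fun y => (hasStrictFDerivAt_norm_sq y).hasFDerivAt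
  have hd1 : ∀ v : EuclideanSpace ℝ (Fin n),
      (fun y => fderiv ℝ (fun y : EuclideanSpace ℝ (Fin n) => F (‖y‖ ^ 2)) y v)
        = fun y => F₁ (‖y‖ ^ 2) * (2 * innerSL ℝ v y) := by
    intro v
    funext y
    have h : HasFDerivAt (fun y : EuclideanSpace ℝ (Fin n) => F (‖y‖ ^ 2)) _ y :=
      (h1 (‖y‖ ^ 2)).comp_hasFDerivAt y (hN y)
    rw [h.fderiv]
    simp [real_inner_comm]
  have hFc : ContDiff ℝ 2 (fun y : EuclideanSpace ℝ (Fin n) => F (‖y‖ ^ 2)) :=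
    hF.comp (contDiff_norm_sq ℝ)
  rw [laplacian_eq_sum_fderiv hFc.contDiffAt]
  have hd2 : ∀ i : Fin n, fderiv ℝ (fun y => fderiv ℝ
      (fun y : EuclideanSpace ℝ (Fin n) => F (‖y‖ ^ 2)) y (EuclideanSpace.single i 1)) x
        (EuclideanSpace.single i 1) = 4 * F₂ (‖x‖ ^ 2) * x i ^ 2 + 2 * F₁ (‖x‖ ^ 2) := by
    intro i
    rw [hd1]
    have e1 : HasFDerivAt (fun y : EuclideanSpace ℝ (Fin n) => F₁ (‖y‖ ^ 2)) _ x :=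
      (h2 (‖x‖ ^ 2)).comp_hasFDerivAt x (hN x)
    have e2 := ((innerSL ℝ (EuclideanSpace.single i (1 : ℝ))).hasFDerivAt (x := x)).const_mul 2
    rw [(e1.fun_mul e2).fderiv]
    simp [EuclideanSpace.inner_single_left, EuclideanSpace.inner_single_right]
    ring
  rw [Finset.sum_congr rfl fun i _ => hd2 i, Finset.sum_add_distrib, ← Finset.mul_sum,
    EuclideanSpace.real_norm_sq_eq]
  simp
  ring

/-- A smooth radial profile `ρ`, supported in the unit ball, whose rescalings differ by the
Laplacian of a nonnegative compactly supported function. -/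
lemma exists_radial_kernel (hn : 0 < n) :
    ∃ ρ : EuclideanSpace ℝ (Fin n) → ℝ, ContDiff ℝ ∞ ρ ∧ (∀ x, 0 ≤ ρ x) ∧ (∃ x, ρ x ≠ 0) ∧
      (∀ x ∉ Metric.closedBall (0 : EuclideanSpace ℝ (Fin n)) 1, ρ x = 0) ∧
      ∀ ε R : ℝ, 0 < ε → ε < R → ∃ Φ : EuclideanSpace ℝ (Fin n) → ℝ, ContDiff ℝ ∞ Φ ∧
        (∀ x, 0 ≤ Φ x) ∧ HasCompactSupport Φ ∧
        ∀ x, -laplacian Φ x = ε⁻¹ ^ n * ρ (ε⁻¹ • x) - R⁻¹ ^ n * ρ (R⁻¹ • x) := by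
  let a : ContDiffBump (3 / 4 : ℝ) := ⟨1 / 8, 1 / 4, by norm_num, by norm_num⟩
  have ha : ContDiff ℝ ∞ a := a.contDiff
  have ha_low : ∀ t ≤ (1 / 2 : ℝ), a t = 0 := fun t ht => by
    refine a.zero_of_le_dist ?_
    rw [Real.dist_eq, abs_sub_comm, abs_of_nonneg (by linarith)]
    change (1 / 4 : ℝ) ≤ _
    linarith
  have ha_high : ∀ t, (1 : ℝ) ≤ t → a t = 0 := fun t ht => by
    refine a.zero_of_le_dist ?_
    rw [Real.dist_eq, abs_of_nonneg (by linarith)]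
    change (1 / 4 : ℝ) ≤ _
    linarith
  have hrpow : ∀ (q : ℝ) {b : ℝ → ℝ} {δ : ℝ}, 0 < δ → ContDiff ℝ ∞ b → (∀ t ≤ δ, b t = 0) →
      ContDiff ℝ ∞ fun t => t ^ q * b t := by
    intro q b δ hδ hb hb0
    refine contDiff_iff_contDiffAt.2 fun t => ?_
    rcases lt_or_ge t δ with h | h
    · refine (contDiffAt_const (c := (0 : ℝ))).congr_of_eventuallyEq ?_
      filter_upwards [Iio_mem_nhds h] with s hs
      simp [hb0 s (le_of_lt hs)]
    · exact (Real.contDiffAt_rpow_const_of_ne (by linarith : t ≠ 0)).mul hb.contDiffAt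
  set g : ℝ → ℝ := fun t => t ^ (1 - (n : ℝ) / 2) * (4 * a t) with hg
  have hgs : ContDiff ℝ ∞ g :=
    hrpow _ one_half_pos (contDiff_const.mul ha) fun t ht => by simp [ha_low t ht]
  set A : ℝ → ℝ := fun s => ∫ t in (0 : ℝ)..s, a t with hA
  have hAd : ∀ s, HasDerivAt A (a s) s := fun s =>
    intervalIntegral.integral_hasDerivAt_right (a.continuous.intervalIntegrable _ _)
      (a.continuous.stronglyMeasurableAtFilter _ _) a.continuous.continuousAt
  have hAs : ContDiff ℝ ∞ A := by
    refine contDiff_infty_iff_deriv.2 ⟨fun s => (hAd s).differentiableAt, ?_⟩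
    rwa [show deriv A = a from funext fun s => (hAd s).deriv]
  have hAmono : Monotone A := monotone_of_deriv_nonneg (fun s => (hAd s).differentiableAt)
    fun s => by rw [(hAd s).deriv]; exact a.nonneg
  have hA_low : ∀ s ≤ (1 / 2 : ℝ), A s = 0 := by
    intro s hs
    rw [hA]
    refine intervalIntegral.integral_zero_ae (Eventually.of_forall fun t ht => ha_low t ?_)
    have := ht.2
    rcases max_choice 0 s with h | h <;> rw [h] at this <;> linarith
  have hA_high : ∀ s, (1 : ℝ) ≤ s → A s = A 1 := by
    intro s hs
    rw [← sub_eq_zero]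
    simp only [hA]
    rw [intervalIntegral.integral_interval_sub_left (a.continuous.intervalIntegrable _ _)
      (a.continuous.intervalIntegrable _ _)]
    refine intervalIntegral.integral_zero_ae (Eventually.of_forall fun t ht => ha_high t ?_)
    rw [uIoc_of_le hs] at ht
    exact ht.1.le
  refine ⟨fun x => g (‖x‖ ^ 2), hgs.comp (contDiff_norm_sq ℝ), fun x => ?_, ?_, fun x hx => ?_, ?_⟩
  · have : 0 ≤ a (‖x‖ ^ 2) := a.nonneg
    simp only [hg]
    positivity
  · refine ⟨EuclideanSpace.single ⟨0, hn⟩ (√(3 / 4)), ?_⟩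
    have e : ‖(EuclideanSpace.single ⟨0, hn⟩ (√(3 / 4)) : EuclideanSpace ℝ (Fin n))‖ ^ 2
        = 3 / 4 := by
      rw [PiLp.norm_single, Real.norm_eq_abs, sq_abs, Real.sq_sqrt (by norm_num)]
    change g (‖_‖ ^ 2) ≠ 0
    rw [e]
    have : a (3 / 4) = 1 := a.one_of_mem_closedBall (Metric.mem_closedBall_self a.rIn_pos.le)
    simp only [hg, this]
    positivity
  · rw [Metric.mem_closedBall, dist_zero_right, not_le] at hx
    simp [hg, ha_high _ (one_le_pow₀ hx.le : 1 ≤ ‖x‖ ^ 2)]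
  intro ε R hε hεR
  have hR : 0 < R := hε.trans hεR
  have he2 : (0 : ℝ) < ε ^ 2 := by positivity
  have hr2 : (0 : ℝ) < R ^ 2 := by positivity
  have her : ε ^ 2 ≤ R ^ 2 := by gcongr
  set b : ℝ → ℝ := fun t => A (t / ε ^ 2) - A (t / R ^ 2) with hb
  have hb_low : ∀ t ≤ ε ^ 2 / 2, b t = 0 := by
    intro t ht
    simp only [hb]
    rw [hA_low _ (by rw [div_le_iff₀ he2]; linarith), hA_low _ (by rw [div_le_iff₀ hr2]; linarith),
      sub_zero]
  have hb_high : ∀ t, R ^ 2 ≤ t → b t = 0 := by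
    intro t ht
    simp only [hb]
    rw [hA_high _ ((one_le_div he2).2 (her.trans ht)), hA_high _ ((one_le_div hr2).2 ht), sub_self]
  have hb0 : ∀ t, 0 ≤ b t := by
    intro t
    rcases le_total t 0 with ht | ht
    · rw [hb_low t (by linarith)]
    · exact sub_nonneg.2 (hAmono (by gcongr))
  have hbd : ∀ t, HasDerivAt b (a (t / ε ^ 2) / ε ^ 2 - a (t / R ^ 2) / R ^ 2) t := by
    intro t
    have h : ∀ d : ℝ, HasDerivAt (fun t => A (t / d)) (a (t / d) / d) t := fun d => by
      have := (hAd (t / d)).comp t ((hasDerivAt_id t).div_const d)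
      simpa [Function.comp_def, div_eq_mul_inv] using this
    exact (h _).sub (h _)
  have hbs : ContDiff ℝ ∞ b :=
    (hAs.comp (contDiff_id.div_const _)).sub (hAs.comp (contDiff_id.div_const _))
  set H : ℝ → ℝ := fun t => t ^ (-((n : ℝ) / 2)) * b t with hH
  have hHs : ContDiff ℝ ∞ H := hrpow _ (by positivity) hbs hb_low
  have hH_low : ∀ t ≤ ε ^ 2 / 2, H t = 0 := fun t ht => by simp [hH, hb_low t ht]
  have hH_high : ∀ t, R ^ 2 ≤ t → H t = 0 := fun t ht => by simp [hH, hb_high t ht]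
  have hH0 : ∀ t, 0 ≤ H t := by
    intro t
    rcases le_total t 0 with ht | ht
    · rw [hH_low t (by linarith)]
    · exact mul_nonneg (Real.rpow_nonneg ht _) (hb0 t)
  set F : ℝ → ℝ := fun s => ∫ t in s..R ^ 2, H t with hF
  have hFd : ∀ s, HasDerivAt F (-H s) s := fun s =>
    intervalIntegral.integral_hasDerivAt_left (hHs.continuous.intervalIntegrable _ _)
      (hHs.continuous.stronglyMeasurableAtFilter _ _) hHs.continuous.continuousAt
  have hFs : ContDiff ℝ ∞ F := by
    refine contDiff_infty_iff_deriv.2 ⟨fun s => (hFd s).differentiableAt, ?_⟩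
    rw [show deriv F = fun s => -H s from funext fun s => (hFd s).deriv]
    exact hHs.neg
  have hF_high : ∀ s, R ^ 2 ≤ s → F s = 0 := by
    intro s hs
    refine intervalIntegral.integral_zero_ae (Eventually.of_forall fun t ht => hH_high t ?_)
    rw [uIoc_of_ge hs] at ht
    exact ht.1.le
  have hF0 : ∀ s, 0 ≤ F s := by
    intro s
    rcases le_total s (R ^ 2) with h | h
    · exact intervalIntegral.integral_nonneg h fun t _ => hH0 t
    · rw [hF_high s h]
  have hHd : ∀ s, HasDerivAt H (deriv H s) s := fun s =>
    ((hHs.differentiable (by decide)) s).hasDerivAt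
  refine ⟨fun x => F (‖x‖ ^ 2), hFs.comp (contDiff_norm_sq ℝ), fun x => hF0 _, ?_, fun x => ?_⟩
  · refine HasCompactSupport.intro (isCompact_closedBall 0 R) fun x hx => hF_high _ ?_
    rw [Metric.mem_closedBall, dist_zero_right, not_le] at hx
    gcongr
  rw [laplacian_comp_norm_sq (hFs.of_le (by decide)) hFd fun s => (hHd s).neg]
  have hscale : ∀ d : ℝ, 0 < d → d⁻¹ ^ n * g (‖d⁻¹ • x‖ ^ 2)
      = (‖x‖ ^ 2) ^ (1 - (n : ℝ) / 2) * (4 * (a (‖x‖ ^ 2 / d ^ 2) / d ^ 2)) := by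
    intro d hd
    have e : ‖d⁻¹ • x‖ ^ 2 = ‖x‖ ^ 2 / d ^ 2 := by
      rw [norm_smul, norm_inv, Real.norm_eq_abs, abs_of_pos hd]
      field_simp
    have e' : d⁻¹ ^ n / (d ^ 2) ^ (1 - (n : ℝ) / 2) = (d ^ 2)⁻¹ := by
      rw [← Real.rpow_natCast d 2, ← Real.rpow_mul hd.le, inv_pow, ← Real.rpow_natCast d n,
        ← Real.rpow_neg hd.le, ← Real.rpow_sub hd, ← Real.rpow_neg hd.le]
      congr 1
      push_cast
      ring
    simp only [hg]
    rw [e, Real.div_rpow (by positivity) (by positivity)]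
    calc _ = (d⁻¹ ^ n / (d ^ 2) ^ (1 - (n : ℝ) / 2)) * ((‖x‖ ^ 2) ^ (1 - (n : ℝ) / 2) *
          (4 * a (‖x‖ ^ 2 / d ^ 2))) := by ring
      _ = _ := by rw [e']; ring
  rw [hscale ε hε, hscale R hR]
  set s := ‖x‖ ^ 2 with hs
  rcases (by positivity : 0 ≤ s).eq_or_lt with h0 | h0
  · rw [← h0, hH_low 0 (by positivity)]
    simp [ha_low 0 (by norm_num)]
  have hHd' : deriv H s = -((n : ℝ) / 2) * s ^ (-((n : ℝ) / 2) - 1) * b s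
      + s ^ (-((n : ℝ) / 2)) * (a (s / ε ^ 2) / ε ^ 2 - a (s / R ^ 2) / R ^ 2) :=
    ((Real.hasDerivAt_rpow_const (Or.inl h0.ne')).mul (hbd s)).deriv
  have e1 : s ^ (-((n : ℝ) / 2) - 1) = s ^ (-((n : ℝ) / 2)) / s := Real.rpow_sub_one h0.ne' _
  have e2 : s ^ (1 - (n : ℝ) / 2) = s ^ (-((n : ℝ) / 2)) * s := by
    rw [← Real.rpow_add_one h0.ne']
    congr 1
    ring
  rw [hHd', e1, e2]
  simp only [hH]
  field_simp
  ring

end Radial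

/-! ### Positivity of the iterated Laplacians -/

section Positivity

variable {n : ℕ}

lemma laplacian_nonneg_of_isLocalMin {w : EuclideanSpace ℝ (Fin n) → ℝ}
    {z : EuclideanSpace ℝ (Fin n)} (hw : ContDiffAt ℝ 2 w z) (hmin : IsLocalMin w z) :
    0 ≤ laplacian w z := by
  rw [laplacian_eq_sum_fderiv hw]
  refine Finset.sum_nonneg fun i _ => ?_
  set v : EuclideanSpace ℝ (Fin n) := EuclideanSpace.single i 1
  by_contra! hneg
  have hγ : ∀ t : ℝ, HasDerivAt (fun t : ℝ => z + t • v) v t := fun t => by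
    simpa using ((hasDerivAt_id t).smul_const v).const_add z
  have hγ0 : Tendsto (fun t : ℝ => z + t • v) (𝓝 0) (𝓝 z) := by
    simpa using (hγ 0).continuousAt.tendsto
  set g : ℝ → ℝ := fun t => w (z + t • v) with hg
  have hgd : deriv g =ᶠ[𝓝 0] fun t => fderiv ℝ w (z + t • v) v := by
    filter_upwards [hγ0.eventually (hw.eventually (by decide))] with t ht
    exact ((ht.differentiableAt (by decide)).hasFDerivAt.comp_hasDerivAt t (hγ t)).deriv
  have hD : DifferentiableAt ℝ (fun y => fderiv ℝ w y v) z :=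
    ((hw.fderiv_right (m := 1) (by norm_num)).differentiableAt (by decide)).clm_apply
      (differentiableAt_const v)
  have hdd : deriv (deriv g) 0 = fderiv ℝ (fun y => fderiv ℝ w y v) z v := by
    rw [hgd.deriv_eq]
    have hD' : HasFDerivAt (fun y => fderiv ℝ w y v)
        (fderiv ℝ (fun y => fderiv ℝ w y v) z) (z + (0 : ℝ) • v) := by
      simpa using hD.hasFDerivAt
    exact (hD'.comp_hasDerivAt (0 : ℝ) (hγ 0)).deriv
  have hgmin : IsLocalMin g 0 := by
    filter_upwards [hγ0.eventually hmin] with t ht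
    simpa [hg] using ht
  have hgc : ContinuousAt g 0 := by
    have : ContinuousAt w (z + (0 : ℝ) • v) := by simpa using hw.continuousAt
    exact this.comp (f := fun t : ℝ => z + t • v) (hγ 0).continuousAt
  have hgmax : IsLocalMax g 0 :=
    isLocalMax_of_deriv_deriv_neg (hdd ▸ hneg) hgmin.deriv_eq_zero hgc
  have hconst : g =ᶠ[𝓝 0] fun _ => g 0 := by
    filter_upwards [hgmin, hgmax] with t h1 h2 using le_antisymm h2 h1
  have h0 : deriv (deriv g) 0 = 0 := by
    rw [hconst.deriv.deriv_eq]
    simp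
  rw [hdd] at h0
  exact hneg.ne h0

/-- If `(-Δ)^(j+1) u ≥ 0` away from the origin and the means of `u` over large balls are bounded,
then `(-Δ)^j u ≥ 0` away from the origin. -/
lemma negLapPow_nonneg_of_negLapPow_succ_nonneg {u : EuclideanSpace ℝ (Fin n) → ℝ} {j : ℕ}
    (hj : 1 ≤ j) (hn : 2 * (j + 1) < n) (hupos : ∀ x, 0 < u x) (hu : Continuous u)
    (hus : ContDiffOn ℝ ((2 * (j + 1) : ℕ) : WithTop ℕ∞) u {(0 : EuclideanSpace ℝ (Fin n))}ᶜ)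
    (hgrowth : ∃ C : ℝ, 0 ≤ C ∧ ∀ R : ℝ, 1 ≤ R →
      ∫ x in Metric.ball (0 : EuclideanSpace ℝ (Fin n)) (R / 2), u x ≤ C * R ^ n)
    (hsucc : ∀ x, x ≠ 0 → 0 ≤ negLapPow (j + 1) u x)
    {z : EuclideanSpace ℝ (Fin n)} (hz : z ≠ 0) : 0 ≤ negLapPow j u z := by
  by_contra! hneg
  obtain ⟨C, hC0, hC⟩ := hgrowth
  obtain ⟨ρ, hρ, hρ0, ⟨y, hy⟩, hρ1, hΦ⟩ := exists_radial_kernel (n := n) (by omega)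
  have hU : IsOpen {(0 : EuclideanSpace ℝ (Fin n))}ᶜ := isOpen_compl_singleton
  have hwc : ContinuousOn (negLapPow j u) {(0 : EuclideanSpace ℝ (Fin n))}ᶜ :=
    (ContDiffOn.negLapPow_of_isOpen (l := 2) hU hus).continuousOn
  have hus' : ContDiffOn ℝ ((2 * j : ℕ) : WithTop ℕ∞) u {(0 : EuclideanSpace ℝ (Fin n))}ᶜ :=
    hus.of_le (by exact_mod_cast (by omega : 2 * j ≤ 2 * (j + 1)))
  obtain ⟨ε, hε, hεball⟩ : ∃ ε > 0, Metric.closedBall z ε ⊆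
      {x | x ∈ ({(0 : EuclideanSpace ℝ (Fin n))}ᶜ : Set _) ∧ negLapPow j u x < 0} := by
    refine Metric.nhds_basis_closedBall.mem_iff.1 ?_
    exact inter_mem (hU.mem_nhds hz)
      ((hwc.continuousAt (hU.mem_nhds hz)).eventually_lt continuousAt_const hneg)
  -- the rescaled kernels
  set P : ℝ → EuclideanSpace ℝ (Fin n) → ℝ := fun r x => r⁻¹ ^ n * ρ (r⁻¹ • (x - z)) with hP
  have hPs : ∀ r, ContDiff ℝ ∞ (P r) := fun r =>
    contDiff_const.mul (hρ.comp ((contDiff_id.sub contDiff_const).const_smul r⁻¹))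
  have hPsupp : ∀ r, 0 < r → tsupport (P r) ⊆ Metric.closedBall z r := by
    intro r hr
    refine closure_minimal (fun x hx => ?_) Metric.isClosed_closedBall
    by_contra h
    refine hx ?_
    simp only [hP]
    rw [hρ1, mul_zero]
    rw [Metric.mem_closedBall, dist_eq_norm, not_le] at h
    rwa [Metric.mem_closedBall, dist_zero_right, norm_smul, norm_inv, Real.norm_eq_abs,
      abs_of_pos hr, not_le, inv_mul_eq_div, one_lt_div hr]
  have hPc : ∀ r, 0 < r → HasCompactSupport (P r) := fun r hr =>
    (isCompact_closedBall z r).of_isClosed_subset (isClosed_tsupport _) (hPsupp r hr)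
  have hPLc : ∀ r, 0 < r → HasCompactSupport (negLapPow j (P r)) := fun r hr =>
    (hPc r hr).of_isClosed_subset (isClosed_tsupport _) (tsupport_negLapPow_subset _ _)
  have huP_int : ∀ r, 0 < r → Integrable fun x => u x * negLapPow j (P r) x := fun r hr =>
    (hu.mul ((hPs r).negLapPow j).continuous).integrable_of_hasCompactSupport (hPLc r hr).mul_left
  -- the small kernel sees the negative value
  have hθ : ∫ x, u x * negLapPow j (P ε) x < 0 := by
    have hsub : tsupport (P ε) ⊆ {(0 : EuclideanSpace ℝ (Fin n))}ᶜ := fun x hx =>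
      (hεball (hPsupp ε hε hx)).1
    rw [← integral_negLapPow_mul hU hus' (hPs ε) (hPc ε hε) hsub, ← neg_pos, ← integral_neg]
    have hcont := (hwc.continuous_mul_of_tsupport_subset hU (hPs ε).continuous hsub).neg
    refine hcont.integral_pos_of_hasCompactSupport_nonneg_nonzero (x := z + ε • y)
      (hPc ε hε).mul_left.neg (fun x => ?_) ?_
    · by_cases hx : x ∈ tsupport (P ε)
      · have h1 := (hεball (hPsupp ε hε hx)).2
        have h2 : 0 ≤ P ε x := mul_nonneg (by positivity) (hρ0 _)
        exact neg_nonneg.2 (mul_nonpos_of_nonpos_of_nonneg h1.le h2)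
      · simp [image_eq_zero_of_notMem_tsupport hx]
    · have hPy : P ε (z + ε • y) ≠ 0 := by
        simp only [hP]
        rw [add_sub_cancel_left, smul_smul, inv_mul_cancel₀ hε.ne', one_smul]
        exact mul_ne_zero (by positivity) hy
      have h1 := (hεball (hPsupp ε hε (subset_tsupport _ hPy))).2
      exact neg_ne_zero.2 (mul_ne_zero h1.ne hPy)
  -- comparison of the kernels at two scales
  have hcomp : ∀ R, ε < R →
      ∫ x, u x * negLapPow j (P R) x ≤ ∫ x, u x * negLapPow j (P ε) x := by
    intro R hεR
    obtain ⟨Φ, hΦs, hΦ0, hΦc, hΦl⟩ := hΦ ε R hε hεR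
    set φ : EuclideanSpace ℝ (Fin n) → ℝ := fun x => 1 * Φ ((1 : ℝ) • (x - z)) with hφ
    have hφs : ContDiff ℝ ∞ φ :=
      contDiff_const.mul (hΦs.comp ((contDiff_id.sub contDiff_const).const_smul (1 : ℝ)))
    have hφc : HasCompactSupport φ := by
      have : φ = Φ ∘ (Homeomorph.subRight z) := by
        funext x
        simp [hφ]
      rw [this]
      exact hΦc.comp_homeomorph _
    have hφl : (fun x => -laplacian φ x) = fun x => P ε x - P R x := by
      funext x
      rw [laplacian_const_mul_comp_smul_sub hΦs]
      have := hΦl (x - z)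
      simp only [hP, ← this, one_smul]
      ring
    have key := integral_le_integral_mul_negLapPow (G := fun _ => 0) hn hu hus hφs hφc
      continuous_const HasCompactSupport.zero
      fun x hx => mul_nonneg (hsucc x hx) (by simpa [hφ] using hΦ0 (x - z))
    rw [integral_zero, negLapPow_succ_eq_negLapPow, hφl, negLapPow_sub (hPs ε) (hPs R)] at key
    simp only [mul_sub] at key
    rw [integral_sub (huP_int ε hε) (huP_int R (hε.trans hεR))] at key
    linarith
  -- the large kernel contributes little
  obtain ⟨D, hD⟩ : ∃ D, ∀ x, ‖negLapPow j ρ x‖ ≤ D := by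
    have hρc : HasCompactSupport ρ :=
      HasCompactSupport.intro (isCompact_closedBall 0 1) hρ1
    exact (hρ.negLapPow j).continuous.bounded_above_of_compact_support
      (hρc.of_isClosed_subset (isClosed_tsupport _) (tsupport_negLapPow_subset _ _))
  have hD0 : 0 ≤ D := (norm_nonneg _).trans (hD 0)
  have hlarge : ∀ R, ‖z‖ + 1 ≤ R →
      |∫ x, u x * negLapPow j (P R) x| ≤ D * C * 4 ^ n / R := by
    intro R hR
    have hR1 : 1 ≤ R := by linarith [norm_nonneg z]
    have hR0 : 0 < R := by linarith
    have hsub : Metric.closedBall z R ⊆ Metric.ball 0 (4 * R / 2) := by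
      refine Metric.closedBall_subset_ball' ?_
      rw [dist_zero_right]
      linarith
    have hbound : ∀ x, ‖u x * negLapPow j (P R) x‖ ≤
        (Metric.ball (0 : EuclideanSpace ℝ (Fin n)) (4 * R / 2)).indicator
          (fun x => R⁻¹ ^ n * R⁻¹ ^ (2 * j) * D * u x) x := by
      intro x
      by_cases hx : x ∈ Metric.ball (0 : EuclideanSpace ℝ (Fin n)) (4 * R / 2)
      · rw [indicator_of_mem hx, norm_mul, Real.norm_of_nonneg (hupos x).le,
          negLapPow_const_mul_comp_smul_sub hρ, norm_mul, Real.norm_of_nonneg (by positivity),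
          mul_comm]
        have := hupos x
        gcongr
        exact hD _
      · rw [indicator_of_notMem hx, image_eq_zero_of_notMem_tsupport fun h =>
          hx (hsub (hPsupp R hR0 (tsupport_negLapPow_subset _ _ h)))]
        simp
    have huint : IntegrableOn u (Metric.ball 0 (4 * R / 2)) :=
      (hu.continuousOn.integrableOn_compact (isCompact_closedBall 0 (4 * R / 2))).mono_set
        Metric.ball_subset_closedBall
    calc |∫ x, u x * negLapPow j (P R) x|
        ≤ ∫ x, (Metric.ball (0 : EuclideanSpace ℝ (Fin n)) (4 * R / 2)).indicator
            (fun x => R⁻¹ ^ n * R⁻¹ ^ (2 * j) * D * u x) x :=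
          norm_integral_le_of_norm_le
            ((integrable_indicator_iff measurableSet_ball).2 (huint.const_mul _))
            (Eventually.of_forall hbound)
      _ = R⁻¹ ^ n * R⁻¹ ^ (2 * j) * D *
            ∫ x in Metric.ball (0 : EuclideanSpace ℝ (Fin n)) (4 * R / 2), u x := by
          rw [integral_indicator measurableSet_ball, integral_const_mul]
      _ ≤ R⁻¹ ^ n * R⁻¹ ^ (2 * j) * D * (C * (4 * R) ^ n) := by
          gcongr
          exact hC _ (by linarith)
      _ = (R⁻¹ * R) ^ n * (D * C * 4 ^ n) * R⁻¹ ^ (2 * j) := by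
          rw [mul_pow, mul_pow]
          ring
      _ ≤ (R⁻¹ * R) ^ n * (D * C * 4 ^ n) * R⁻¹ ^ 1 := by
          gcongr ?_ * ?_
          exact pow_le_pow_of_le_one (by positivity) (inv_le_one_of_one_le₀ hR1) (by omega)
      _ = D * C * 4 ^ n / R := by
          rw [inv_mul_cancel₀ hR0.ne']
          ring
  have hlim : Tendsto (fun R : ℝ => D * C * 4 ^ n / R) atTop (𝓝 0) :=
    tendsto_const_nhds.div_atTop tendsto_id
  obtain ⟨R, hR1, hR2, hR3⟩ := ((hlim.eventually_lt_const (neg_pos.2 hθ)).and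
    ((eventually_gt_atTop ε).and (eventually_ge_atTop (‖z‖ + 1)))).exists
  linarith [hcomp R hR2, (abs_le.1 (hlarge R hR3)).1]

end Positivity

theorem stmt_17 (n k : ℕ) (hk : 2 ≤ k) (hn : 2 * k < n) (σ p c : ℝ)
    (hσ0 : 0 ≤ σ) (hσk : σ < 2 * (k : ℝ)) (hp : 1 < p) (hc : 0 < c)
    (u : EuclideanSpace ℝ (Fin n) → ℝ)
    (hupos : ∀ x, 0 < u x) (hucont : Continuous u)
    (husmooth : ContDiffOn ℝ (2 * k) u {(0 : EuclideanSpace ℝ (Fin n))}ᶜ)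
    (hineq : ∀ x : EuclideanSpace ℝ (Fin n), x ≠ 0 →
      c * ‖x‖ ^ (-σ) * u x ^ p ≤ negLapPow k u x) :
    ∀ x : EuclideanSpace ℝ (Fin n), x ≠ 0 →
      ∀ j : ℕ, 1 ≤ j → j ≤ k - 1 → 0 < negLapPow j u x := by
  have hs : ContDiffOn ℝ ((2 * k : ℕ) : WithTop ℕ∞) u {(0 : EuclideanSpace ℝ (Fin n))}ᶜ := by
    exact_mod_cast husmooth
  have hgrowth := exists_setIntegral_ball_le hn hσ0 hσk hp hc hupos hucont hs hineq
  have hU : IsOpen {(0 : EuclideanSpace ℝ (Fin n))}ᶜ := isOpen_compl_singleton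
  have main : ∀ i j : ℕ, i + j = k → 1 ≤ j →
      ∀ x : EuclideanSpace ℝ (Fin n), x ≠ 0 → 0 < negLapPow j u x := by
    intro i
    induction i with
    | zero =>
      intro j hjk _ x hx
      obtain rfl : j = k := by omega
      have h1 : 0 < ‖x‖ := norm_pos_iff.2 hx
      have h2 := hupos x
      exact lt_of_lt_of_le (by positivity) (hineq x hx)
    | succ i ih =>
      intro j hjk hj x hx
      have hsucc := ih (j + 1) (by omega) (by omega)
      have hs' : ContDiffOn ℝ ((2 * (j + 1) : ℕ) : WithTop ℕ∞) u
          {(0 : EuclideanSpace ℝ (Fin n))}ᶜ :=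
        hs.of_le (by exact_mod_cast (by omega : 2 * (j + 1) ≤ 2 * k))
      have hnonneg : ∀ y : EuclideanSpace ℝ (Fin n), y ≠ 0 → 0 ≤ negLapPow j u y :=
        fun y hy => negLapPow_nonneg_of_negLapPow_succ_nonneg hj (by omega) hupos hucont hs'
          hgrowth (fun y hy => (hsucc y hy).le) hy
      refine (hnonneg x hx).lt_of_ne fun h0 => ?_
      have hw : ContDiffAt ℝ 2 (negLapPow j u) x :=
        (ContDiffOn.negLapPow_of_isOpen (l := 2) hU hs').contDiffAt (hU.mem_nhds hx)
      have hmin : IsLocalMin (negLapPow j u) x := by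
        filter_upwards [hU.mem_nhds hx] with y hy
        rw [← h0]
        exact hnonneg y hy
      have h1 := laplacian_nonneg_of_isLocalMin hw hmin
      have h2 := hsucc x hx
      rw [negLapPow_succ] at h2
      linarith
  intro x hx j hj hjk
  exact main (k - j) j (by omega) hj x hx
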